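/- Let f : ℝ⁸ → 𝕆 be given in octonionic coordinates by f(x) = x₁ − x₂e₄, and set g(x) = f(x)·e₃ = x₁e₃ − x₂e₇. Then 𝒟g = e₁e₃ − e₂e₇ = 2e₅ ≠ 0 at every point; in particular, g is not left octonionic monogenic, even though f is. -/

import Mathlib

open Quaternion

/-- The octonions `𝕆`, realised via the Cayley–Dickson doubling of the quaternions:
`𝕆 = ℍ × ℍ` with multiplication `(a,b)(c,d) = (ac - d̄b, da + bc̄)`. -/
def Octonion : Type := ℍ[ℝ] × ℍ[ℝ]

namespace Octonion

def ofPair (x : ℍ[ℝ] × ℍ[ℝ]) : Octonion := x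
def toPair (x : Octonion) : ℍ[ℝ] × ℍ[ℝ] := x

noncomputable instance : NormedAddCommGroup Octonion :=
  inferInstanceAs (NormedAddCommGroup (ℍ[ℝ] × ℍ[ℝ]))

noncomputable instance : NormedSpace ℝ Octonion :=
  inferInstanceAs (NormedSpace ℝ (ℍ[ℝ] × ℍ[ℝ]))

noncomputable instance : One Octonion := ⟨ofPair (1, 0)⟩

/-- Cayley–Dickson multiplication `(a,b)(c,d) = (ac - d̄b, da + bc̄)`.
It is non-associative but alternative, and reproduces the standard octonion
multiplication table for the basis `e` below (`e₄ = e₁e₂`, `e₅ = e₁e₃`,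
`e₆ = e₂e₃`, `e₇ = (e₁e₂)e₃`, `eᵢ² = -1` for `i ≠ 0`, and `eᵢeⱼ = -eⱼeᵢ`
for distinct `i, j ∈ {1,…,7}`). -/
noncomputable instance : Mul Octonion :=
  ⟨fun x y => ofPair
    ((toPair x).1 * (toPair y).1 - star (toPair y).2 * (toPair x).2,
     (toPair y).2 * (toPair x).1 + (toPair x).2 * star (toPair y).1)⟩

/-- The standard basis `e₀ = 1, e₁, …, e₇` of the octonions:
`e₀ = (1,0)`, `e₁ = (i,0)`, `e₂ = (j,0)`, `e₃ = (0,1)`, `e₄ = e₁e₂ = (k,0)`,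
`e₅ = e₁e₃ = (0,i)`, `e₆ = e₂e₃ = (0,j)`, `e₇ = (e₁e₂)e₃ = (0,k)`. -/
noncomputable def e : Fin 8 → Octonion := fun i => ofPair
  (![((1 : ℍ[ℝ]), (0 : ℍ[ℝ])),
     ((⟨0,1,0,0⟩ : ℍ[ℝ]), (0 : ℍ[ℝ])),
     ((⟨0,0,1,0⟩ : ℍ[ℝ]), (0 : ℍ[ℝ])),
     ((0 : ℍ[ℝ]), (1 : ℍ[ℝ])),
     ((⟨0,0,0,1⟩ : ℍ[ℝ]), (0 : ℍ[ℝ])),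
     ((0 : ℍ[ℝ]), (⟨0,1,0,0⟩ : ℍ[ℝ])),
     ((0 : ℍ[ℝ]), (⟨0,0,1,0⟩ : ℍ[ℝ])),
     ((0 : ℍ[ℝ]), (⟨0,0,0,1⟩ : ℍ[ℝ]))] i)

end Octonion

namespace Octonion

/-- The real coordinates `x₀, …, x₇` of an octonion `x = Σᵢ xᵢ eᵢ`
with respect to the basis `e`. -/
noncomputable def coord : Fin 8 → Octonion → ℝ := fun i x =>
  ![(toPair x).1.re, (toPair x).1.imI, (toPair x).1.imJ, (toPair x).2.re,
    (toPair x).1.imK, (toPair x).2.imI, (toPair x).2.imJ, (toPair x).2.imK] i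

/-- The octonionic Cauchy–Riemann operator
`𝒟 f = ∂f/∂x₀ + Σ_{i=1}^{7} eᵢ ∂f/∂xᵢ`, the partial derivative `∂f/∂xᵢ` at `x`
being the directional derivative of `f` at `x` in the direction `eᵢ`. -/
noncomputable def CauchyRiemann (f : Octonion → Octonion) (x : Octonion) : Octonion :=
  fderiv ℝ f x (e 0) + ∑ i ∈ Finset.univ.erase (0 : Fin 8), e i * fderiv ℝ f x (e i)

/-- A function `f : ℝ⁸ ≅ 𝕆 → 𝕆` is left octonionic monogenic if `𝒟 f = 0` everywhere. -/
def LeftMonogenic (f : Octonion → Octonion) : Prop :=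
  ∀ x : Octonion, CauchyRiemann f x = 0

end Octonion

namespace Octonion

lemma ext_coord {x y : Octonion} (h : ∀ i, coord i x = coord i y) : x = y :=
  Prod.ext (Quaternion.ext _ _ (h 0) (h 1) (h 2) (h 4))
    (Quaternion.ext _ _ (h 3) (h 5) (h 6) (h 7))

lemma toPair_add (x y : Octonion) : toPair (x + y) = toPair x + toPair y := rfl

lemma toPair_sub (x y : Octonion) : toPair (x - y) = toPair x - toPair y := rfl

lemma toPair_neg (x : Octonion) : toPair (-x) = -toPair x := rfl

lemma toPair_zero : toPair 0 = 0 := rfl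

lemma toPair_one : toPair 1 = (1, 0) := rfl

lemma toPair_smul (r : ℝ) (x : Octonion) : toPair (r • x) = r • toPair x := rfl

lemma toPair_ofPair (x : ℍ[ℝ] × ℍ[ℝ]) : toPair (ofPair x) = x := rfl

lemma toPair_mul (x y : Octonion) : toPair (x * y) =
    ((toPair x).1 * (toPair y).1 - star (toPair y).2 * (toPair x).2,
      (toPair y).2 * (toPair x).1 + (toPair x).2 * star (toPair y).1) := rfl

lemma mul_zero' (x : Octonion) : x * 0 = 0 := by
  change toPair (x * 0) = 0
  simp [toPair_mul, toPair_zero]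

lemma mul_neg' (x y : Octonion) : x * -y = -(x * y) := by
  change toPair (x * -y) = toPair (-(x * y))
  simp [toPair_mul, toPair_neg]
  constructor <;> abel

instance : FiniteDimensional ℝ Octonion :=
  inferInstanceAs (FiniteDimensional ℝ (ℍ[ℝ] × ℍ[ℝ]))

/-- The `i`-th coordinate as a continuous linear functional. -/
noncomputable def coordCLM (i : Fin 8) : Octonion →L[ℝ] ℝ :=
  LinearMap.toContinuousLinearMap
    { toFun := coord i
      map_add' := fun x y => by fin_cases i <;> simp [coord, toPair_add]
      map_smul' := fun r x => by fin_cases i <;> simp [coord, toPair_smul] }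

lemma coord_e (i j : Fin 8) : coord i (e j) = if i = j then 1 else 0 := by
  fin_cases i <;> fin_cases j <;> simp [coord, e, toPair_ofPair]

lemma fderiv_coord_smul_sub (a b x v : Octonion) :
    fderiv ℝ (fun y : Octonion => coord 1 y • a - coord 2 y • b) x v =
      coord 1 v • a - coord 2 v • b :=
  congrArg (· v)
    ((coordCLM 1).smulRight a - (coordCLM 2).smulRight b).hasFDerivAt.fderiv

lemma cauchyRiemann_coord_smul_sub (a b x : Octonion) :
    CauchyRiemann (fun y : Octonion => coord 1 y • a - coord 2 y • b) x =
      e 1 * a - e 2 * b := by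
  have h : Finset.univ.erase (0 : Fin 8) = {1, 2, 3, 4, 5, 6, 7} := by decide
  simp [CauchyRiemann, fderiv_coord_smul_sub, coord_e, h, mul_zero', mul_neg', ← sub_eq_add_neg]

lemma coord_smul_sub_mul_e_three (x : Octonion) :
    (coord 1 x • (1 : Octonion) - coord 2 x • e 4) * e 3 =
      coord 1 x • e 3 - coord 2 x • e 7 := by
  generalize coord 1 x = r
  generalize coord 2 x = s
  refine ext_coord fun i => ?_
  fin_cases i <;>
    simp [coord, e, toPair_mul, toPair_sub, toPair_smul, toPair_one, toPair_ofPair]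

lemma e_one_mul_e_three_sub : e 1 * e 3 - e 2 * e 7 = (2 : ℝ) • e 5 := by
  refine ext_coord fun i => ?_
  fin_cases i <;>
    simp [coord, toPair_mul, toPair_sub, toPair_smul] <;>
    simp [e, toPair_ofPair]
  norm_num

lemma e_one_mul_one_sub : e 1 * 1 - e 2 * e 4 = 0 := by
  refine ext_coord fun i => ?_
  fin_cases i <;>
    simp [coord, toPair_mul, toPair_sub, toPair_zero, toPair_one] <;>
    simp [e, toPair_ofPair]

lemma two_smul_e_five_ne_zero : (2 : ℝ) • e 5 ≠ 0 := fun h => by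
  have h5 := congrArg (coord 5) h
  simp [coord, toPair_smul, toPair_zero] at h5
  simp [e, toPair_ofPair] at h5

end Octonion

open Octonion in
/-- For `f(x) = x₁ - x₂ e₄` and `g(x) = f(x)·e₃` one has
`g(x) = x₁ e₃ - x₂ e₇`, and `𝒟 g = e₁e₃ - e₂e₇ = 2e₅ ≠ 0` at every point;
in particular `g` is not left octonionic monogenic even though `f` is. -/
theorem not_monogenic_after_right_multiplication :
    (∀ x : Octonion,
        (coord 1 x • (1 : Octonion) - coord 2 x • e 4) * e 3
          = coord 1 x • e 3 - coord 2 x • e 7) ∧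
    (∀ x : Octonion,
        CauchyRiemann
          (fun y : Octonion => (coord 1 y • (1 : Octonion) - coord 2 y • e 4) * e 3) x
          = e 1 * e 3 - e 2 * e 7) ∧
    e 1 * e 3 - e 2 * e 7 = (2 : ℝ) • e 5 ∧
    (2 : ℝ) • e 5 ≠ 0 ∧
    ¬ LeftMonogenic
        (fun y : Octonion => (coord 1 y • (1 : Octonion) - coord 2 y • e 4) * e 3) ∧
    LeftMonogenic (fun y : Octonion => coord 1 y • (1 : Octonion) - coord 2 y • e 4) := by
  have hD : ∀ x : Octonion, CauchyRiemann
      (fun y : Octonion => (coord 1 y • (1 : Octonion) - coord 2 y • e 4) * e 3) x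
        = e 1 * e 3 - e 2 * e 7 := fun x => by
    simp only [coord_smul_sub_mul_e_three, cauchyRiemann_coord_smul_sub]
  refine ⟨coord_smul_sub_mul_e_three, hD, e_one_mul_e_three_sub, two_smul_e_five_ne_zero,
    fun h => two_smul_e_five_ne_zero ?_, fun x => ?_⟩
  · rw [← e_one_mul_e_three_sub, ← hD 0, h 0]
  · rw [cauchyRiemann_coord_smul_sub, e_one_mul_one_sub]
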